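/- arXiv:2308.01753 — 2 statements merged into one kernel-verified Lean document; each statement's English description precedes it below -/
import Mathlib

section
/- Let N ≥ 2, let {(u_i,w_i)}_{i=1}^m ⊆ S^{N-1} × [0,∞) be an ε-accurate quadrature, let 𝒮 = {u_i}_{i=1}^m have dispersion δ = disp(𝒮), and assume ε, δ ≤ 1/(10√N). Let γ ≥ 0, set e = δ(L_C + 12√N(‖C‖_∞ + γ)), and for 𝓑 ∈ 𝒟^γ define 𝓑^e = ⋂_{u ∈ S^{N-1}} Π^-(u, B(𝓑,u) + e) (intersection over the whole sphere). Then 𝓑^e ∈ 𝒞^{γ+β} where β = e + 32√N(‖C‖_∞ + γ)ε. -/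
open MeasureTheory Metric Set TopologicalSpace Filter
open scoped RealInnerProductSpace NNReal ENNReal

noncomputable section

abbrev Euc (N : ℕ) := EuclideanSpace ℝ (Fin N)

/-- The outreach (support) function of a set. -/
def outreach {N : ℕ} (B : Set (Euc N)) (u : Euc N) : ℝ :=
  sSup ((fun b => ⟪b, u⟫) '' B)

/-- The half-space `Π⁻(u,b)`. -/
def halfSpace {N : ℕ} (u : Euc N) (b : ℝ) : Set (Euc N) := {x | ⟪u, x⟫ ≤ b}

/-- The uniform probability measure on the unit sphere. -/
def sphereMeasure (N : ℕ) : Measure (Metric.sphere (0 : Euc N) 1) :=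
  (((volume : Measure (Euc N)).toSphere) Set.univ)⁻¹ • ((volume : Measure (Euc N)).toSphere)

/-- The sup-norm of a function restricted to the unit sphere. -/
def supNormSphere {N : ℕ} (f : Euc N → ℝ) : ℝ :=
  ⨆ x : Metric.sphere (0 : Euc N) 1, |f x|

/-- The dispersion of a set of directions. -/
def dispersion {N : ℕ} (S : Set (Euc N)) : ℝ :=
  ⨆ u : Metric.sphere (0 : Euc N) 1, ⨅ v : S, ‖(u : Euc N) - (v : Euc N)‖

/-- `ε`-accurate quadrature on the unit sphere. -/
def IsAccurateQuadrature {N : ℕ} {ι : Type*} [Fintype ι]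
    (u : ι → Euc N) (w : ι → ℝ) (ε : ℝ) : Prop :=
  (∀ i, u i ∈ Metric.sphere (0 : Euc N) 1) ∧ (∀ i, 0 ≤ w i) ∧
  ∀ (L : ℝ≥0) (f : Euc N → ℝ), LipschitzOnWith L f (Metric.sphere (0 : Euc N) 1) →
    |(∫ x : Metric.sphere (0 : Euc N) 1, f x ∂(sphereMeasure N)) - ∑ i, w i * f (u i)|
      ≤ ε * (L + supNormSphere f)

/-- Halved mean width. -/
def meanHalfWidth {N : ℕ} (B : Set (Euc N)) : ℝ :=
  ∫ u : Metric.sphere (0 : Euc N) 1, outreach B (u : Euc N) ∂(sphereMeasure N)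

/-- Feasible solutions of the continuous problem. -/
def CInf {N : ℕ} (C : Euc N → ℝ) : Set (Set (Euc N)) :=
  {B | B.Nonempty ∧ Convex ℝ B ∧ IsCompact B ∧
    ∀ u ∈ Metric.sphere (0 : Euc N) 1, C u ≤ outreach B u}

/-- Optimal value of the continuous problem. -/
def VCP {N : ℕ} (C : Euc N → ℝ) : ℝ := sInf (meanHalfWidth '' CInf C)

/-- `γ`-near optimal solutions of the continuous problem. -/
def CGamma {N : ℕ} (C : Euc N → ℝ) (γ : ℝ) : Set (Set (Euc N)) :=
  {B ∈ CInf C | meanHalfWidth B - VCP C ≤ γ}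

/-- Feasible solutions of the discrete problem with node set `S`. -/
def DInf {N : ℕ} (C : Euc N → ℝ) (S : Set (Euc N)) : Set (Set (Euc N)) :=
  {B | B.Nonempty ∧ Convex ℝ B ∧ IsCompact B ∧ ∀ u ∈ S, C u ≤ outreach B u}

/-- Discrete objective. -/
def quadSum {N : ℕ} {ι : Type*} [Fintype ι] (u : ι → Euc N) (w : ι → ℝ)
    (B : Set (Euc N)) : ℝ :=
  ∑ i, w i * outreach B (u i)

/-- Optimal value of the discrete problem. -/
def VDP {N : ℕ} {ι : Type*} [Fintype ι] (u : ι → Euc N) (w : ι → ℝ) (C : Euc N → ℝ) : ℝ :=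
  sInf (quadSum u w '' DInf C (Set.range u))

/-- `γ`-near optimal solutions of the discrete problem. -/
def DGamma {N : ℕ} {ι : Type*} [Fintype ι] (u : ι → Euc N) (w : ι → ℝ) (C : Euc N → ℝ)
    (γ : ℝ) : Set (Set (Euc N)) :=
  {B ∈ DInf C (Set.range u) | quadSum u w B - VDP u w C ≤ γ}

/-- Radial Gaussian moments. -/
lemma radial_eq (k : ℕ) : ∫ r in Ioi (0 : ℝ), r ^ k * Real.exp (-r ^ 2) =
    1 / 2 * Real.Gamma (((k : ℝ) + 1) / 2) := by
  have h := integral_rpow_mul_exp_neg_mul_rpow (p := 2) (q := k) (b := 1) (by norm_num)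
    (by have : (0 : ℝ) ≤ k := Nat.cast_nonneg k
        linarith) one_pos
  simp only [Real.one_rpow, one_mul, Real.rpow_natCast, Real.rpow_two] at h
  rw [← h]
  simp

lemma radial_integrable (k : ℕ) :
    IntegrableOn (fun r : ℝ => r ^ k * Real.exp (-r ^ 2)) (Ioi 0) := by
  have h := integrable_rpow_mul_exp_neg_mul_sq (b := 1) one_pos (s := k)
    (by have : (0 : ℝ) ≤ k := Nat.cast_nonneg k
        linarith)
  simp only [Real.rpow_natCast] at h
  simpa using h.integrableOn

lemma radial_pos (k : ℕ) : 0 < ∫ r in Ioi (0 : ℝ), r ^ k * Real.exp (-r ^ 2) := by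
  rw [radial_eq]
  have : 0 < Real.Gamma (((k : ℝ) + 1) / 2) := Real.Gamma_pos_of_pos (by positivity)
  positivity

lemma radial_le (n : ℕ) : ∫ r in Ioi (0 : ℝ), r ^ (n + 1) * Real.exp (-r ^ 2) ≤
    Real.sqrt (((n : ℝ) + 1) / 2) * ∫ r in Ioi (0 : ℝ), r ^ n * Real.exp (-r ^ 2) := by
  set s := Real.sqrt (((n : ℝ) + 1) / 2) with hs
  have hs0 : 0 < s := Real.sqrt_pos.2 (by positivity)
  have hs2 : s ^ 2 = ((n : ℝ) + 1) / 2 := Real.sq_sqrt (by positivity)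
  have h1 : ∫ r in Ioi (0 : ℝ), r ^ (n + 2) * Real.exp (-r ^ 2) =
      s ^ 2 * ∫ r in Ioi (0 : ℝ), r ^ n * Real.exp (-r ^ 2) := by
    rw [radial_eq, radial_eq, hs2]
    have : (((n + 2 : ℕ) : ℝ) + 1) / 2 = ((n : ℝ) + 1) / 2 + 1 := by push_cast; ring
    rw [this, Real.Gamma_add_one (by positivity)]
    ring
  have h2 : ∫ r in Ioi (0 : ℝ), r ^ (n + 1) * Real.exp (-r ^ 2) ≤
      ∫ r in Ioi (0 : ℝ), ((2 * s)⁻¹ * (r ^ (n + 2) * Real.exp (-r ^ 2)) +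
        (s / 2) * (r ^ n * Real.exp (-r ^ 2))) := by
    apply setIntegral_mono_on (radial_integrable _)
      (((radial_integrable _).const_mul _).add ((radial_integrable _).const_mul _))
      measurableSet_Ioi
    intro r hr
    have hr : 0 < r := hr
    have h3 : r ≤ (2 * s)⁻¹ * r ^ 2 + s / 2 := by
      rw [← sub_nonneg]
      have : (2 * s)⁻¹ * r ^ 2 + s / 2 - r = (2 * s)⁻¹ * (r - s) ^ 2 := by
        field_simp; ring
      rw [this]; positivity
    have h4 : 0 ≤ r ^ n * Real.exp (-r ^ 2) := by positivity
    calc r ^ (n + 1) * Real.exp (-r ^ 2) = r * (r ^ n * Real.exp (-r ^ 2)) := by ring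
      _ ≤ ((2 * s)⁻¹ * r ^ 2 + s / 2) * (r ^ n * Real.exp (-r ^ 2)) := by gcongr
      _ = _ := by simp only [Pi.add_apply]; ring
  rw [integral_add ((radial_integrable _).const_mul _) ((radial_integrable _).const_mul _),
    integral_const_mul, integral_const_mul, h1] at h2
  refine h2.trans (le_of_eq ?_)
  field_simp; ring

/-- Polar coordinates for a positively homogeneous function times a Gaussian. -/
lemma polar_gauss {n : ℕ} (φ : Euc (n + 1) → ℝ)
    (hφ : ∀ (r : ℝ) (x : Euc (n + 1)), 0 < r → φ (r • x) = r * φ x) :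
    ∫ x : Euc (n + 1), φ x * Real.exp (-‖x‖ ^ 2) =
      (∫ x : Metric.sphere (0 : Euc (n + 1)) 1, φ x ∂((volume : Measure (Euc (n + 1))).toSphere)) *
        ∫ r in Ioi (0 : ℝ), r ^ (n + 1) * Real.exp (-r ^ 2) := by
  set μ : Measure (Euc (n + 1)) := volume
  have hd : Module.finrank ℝ (Euc (n + 1)) - 1 = n := by simp
  calc
    ∫ x : Euc (n + 1), φ x * Real.exp (-‖x‖ ^ 2)
      = ∫ x : ({(0)}ᶜ : Set (Euc (n + 1))), φ x.1 * Real.exp (-‖x.1‖ ^ 2) ∂(μ.comap (↑)) := by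
      rw [integral_subtype_comap (measurableSet_singleton _).compl
        fun x ↦ φ x * Real.exp (-‖x‖ ^ 2), restrict_compl_singleton]
    _ = ∫ x, φ x.1 * ((x.2 : ℝ) * Real.exp (-(x.2 : ℝ) ^ 2))
          ∂μ.toSphere.prod (.volumeIoiPow (Module.finrank ℝ (Euc (n + 1)) - 1)) := by
      rw [← μ.measurePreserving_homeomorphUnitSphereProd.integral_comp
        (Homeomorph.measurableEmbedding _)]
      congr 1
      ext x
      have hx : 0 < ‖(x : Euc (n + 1))‖ := norm_pos_iff.2 x.2
      simp only [homeomorphUnitSphereProd_apply_snd_coe, homeomorphUnitSphereProd_apply_fst_coe]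
      rw [hφ _ _ (inv_pos.2 hx)]
      field_simp
    _ = (∫ x, φ x ∂μ.toSphere) * ∫ x : Ioi (0 : ℝ), ((x : ℝ) * Real.exp (-(x : ℝ) ^ 2))
          ∂.volumeIoiPow (Module.finrank ℝ (Euc (n + 1)) - 1) := by
      exact integral_prod_mul (fun x : Metric.sphere (0 : Euc (n + 1)) 1 => φ x)
        (fun x : Ioi (0 : ℝ) => ((x : ℝ) * Real.exp (-(x : ℝ) ^ 2)))
    _ = _ := by
      rw [hd]
      simp only [Measure.volumeIoiPow, ENNReal.ofReal]
      rw [integral_withDensity_eq_integral_smul,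
        integral_subtype_comap measurableSet_Ioi fun a ↦ Real.toNNReal (a ^ n) •
          (a * Real.exp (-a ^ 2)),
        setIntegral_congr_fun measurableSet_Ioi fun x hx ↦ ?_]
      · simp only [NNReal.smul_def, Real.coe_toNNReal _ (pow_nonneg hx.out.le _), smul_eq_mul]
        ring
      · exact (measurable_subtype_coe.pow_const _).real_toNNReal

lemma gauss_total (n : ℕ) : ∫ x : Euc (n + 1), Real.exp (-‖x‖ ^ 2) =
    ((volume : Measure (Euc (n + 1))).toSphere).real univ *
      ∫ r in Ioi (0 : ℝ), r ^ n * Real.exp (-r ^ 2) := by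
  have := integral_fun_norm_addHaar (volume : Measure (Euc (n + 1))) (fun r => Real.exp (-r ^ 2))
  rw [this, Measure.toSphere_real_apply_univ]
  simp [mul_assoc]

lemma one_dim_half : ∫ x : ℝ, max x 0 * Real.exp (-x ^ 2) = 1 / 2 := by
  have h := radial_eq 1
  have h2 : ∫ x : ℝ, max x 0 * Real.exp (-x ^ 2) =
      ∫ x in Ioi (0 : ℝ), max x 0 * Real.exp (-x ^ 2) := by
    symm
    apply setIntegral_eq_integral_of_forall_compl_eq_zero
    intro x hx
    have : x ≤ 0 := not_lt.1 hx
    simp [max_eq_right this]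
  rw [h2]
  have h3 : ∫ x in Ioi (0 : ℝ), max x 0 * Real.exp (-x ^ 2) =
      ∫ x in Ioi (0 : ℝ), x ^ 1 * Real.exp (-x ^ 2) := by
    apply setIntegral_congr_fun measurableSet_Ioi
    intro x hx
    simp [max_eq_left (le_of_lt (mem_Ioi.1 hx))]
  rw [h3, h]
  norm_num

lemma one_dim_full : ∫ x : ℝ, Real.exp (-x ^ 2) = Real.sqrt Real.pi := by
  have := integral_gaussian 1
  simpa using this

/-- Gaussian integral of a function of one coordinate. -/
lemma gauss_dir {n : ℕ} (b : Euc (n + 1)) (hb : ‖b‖ = 1) (F : ℝ → ℝ) :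
    ∫ x : Euc (n + 1), F ⟪b, x⟫ * Real.exp (-‖x‖ ^ 2) =
      (∫ t : ℝ, F t * Real.exp (-t ^ 2)) * Real.sqrt Real.pi ^ n := by
  obtain ⟨v, hv⟩ := Orthonormal.exists_orthonormalBasis_extension_of_card_eq (𝕜 := ℝ)
    (E := Euc (n + 1)) (ι := Fin (n + 1)) (by simp) (v := fun _ => b) (s := {0})
    (by
      constructor
      · intro i; simpa using hb
      · intro i j hij; exact absurd (Subsingleton.elim i j) hij)
  have hv0 : v 0 = b := hv 0 (by simp)
  rw [← v.measurePreserving_measurableEquiv.symm.integral_comp',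
    ← (PiLp.volume_preserving_toLp (Fin (n + 1))).integral_comp
      (MeasurableEquiv.toLp 2 (Fin (n + 1) → ℝ)).measurableEmbedding]
  have key : ∀ y : Fin (n + 1) → ℝ,
      F ⟪b, v.measurableEquiv.symm (WithLp.toLp 2 y)⟫ *
        Real.exp (-‖v.measurableEquiv.symm (WithLp.toLp 2 y)‖ ^ 2) =
      ∏ i, (Fin.cons (fun t => F t * Real.exp (-t ^ 2)) (fun _ t => Real.exp (-t ^ 2)) :
        Fin (n + 1) → ℝ → ℝ) i (y i) := by
    intro y
    have e1 : v.measurableEquiv.symm (WithLp.toLp 2 y) = v.repr.symm (WithLp.toLp 2 y) := rfl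
    have e2 : ⟪b, v.repr.symm (WithLp.toLp 2 y)⟫ = y 0 := by
      rw [← hv0, ← v.repr_apply_apply]
      simp
    rw [e1, e2, LinearIsometryEquiv.norm_map, EuclideanSpace.norm_sq_eq, Fin.prod_univ_succ,
      Fin.sum_univ_succ, neg_add, Real.exp_add, ← Finset.sum_neg_distrib, Real.exp_sum]
    simp [mul_assoc]
  simp_rw [key]
  rw [integral_fintype_prod_volume_eq_prod, Fin.prod_univ_succ]
  simp [one_dim_full]

lemma gauss_all (n : ℕ) :
    ∫ x : Euc (n + 1), Real.exp (-‖x‖ ^ 2) = Real.sqrt Real.pi ^ (n + 1) := by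
  have h := gauss_dir (EuclideanSpace.single (0 : Fin (n + 1)) (1 : ℝ)) (by simp) (fun _ => 1)
  simp only [one_mul, one_dim_full] at h
  rw [h]; ring

lemma toSphere_mass_pos (n : ℕ) :
    0 < ((volume : Measure (Euc (n + 1))).toSphere).real univ := by
  rw [Measure.toSphere_real_apply_univ]
  have h : 0 < (volume : Measure (Euc (n + 1))).real (ball 0 1) :=
    ENNReal.toReal_pos (measure_ball_pos _ _ one_pos).ne' measure_ball_lt_top.ne
  have : 0 < Module.finrank ℝ (Euc (n + 1)) := by simp
  positivity

lemma sphereMeasure_integral {N : ℕ} (f : Metric.sphere (0 : Euc N) 1 → ℝ) :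
    ∫ x, f x ∂(sphereMeasure N) =
      (((volume : Measure (Euc N)).toSphere).real univ)⁻¹ *
        ∫ x, f x ∂((volume : Measure (Euc N)).toSphere) := by
  simp [sphereMeasure, integral_smul_measure, Measure.real]

instance sphereMeasure_finite (N : ℕ) [NeZero N] : IsProbabilityMeasure (sphereMeasure N) := by
  obtain ⟨n, rfl⟩ := Nat.exists_eq_succ_of_ne_zero (NeZero.ne N)
  constructor
  have h := toSphere_mass_pos n
  rw [sphereMeasure, Measure.smul_apply, smul_eq_mul]
  apply ENNReal.inv_mul_cancel
  · intro h0
    simp only [Measure.real] at h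
    rw [h0] at h
    simp at h
  · exact measure_ne_top _ _

/-- Lower bound on the mean of the positive part of a linear form on the sphere. -/
lemma sphere_pos_part {N : ℕ} (hN : 1 ≤ N) (b : Euc N) :
    0.398 * ‖b‖ ≤ Real.sqrt N *
      ∫ x : Metric.sphere (0 : Euc N) 1, max ⟪b, (x : Euc N)⟫ 0 ∂(sphereMeasure N) := by
  obtain ⟨n, rfl⟩ := Nat.exists_eq_succ_of_ne_zero (by omega : N ≠ 0)
  rcases eq_or_ne b 0 with rfl | hb0
  · simp
  have hbn : 0 < ‖b‖ := norm_pos_iff.2 hb0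
  set c : Euc (n + 1) := ‖b‖⁻¹ • b with hc
  have hc1 : ‖c‖ = 1 := by rw [hc, norm_smul]; simp [hbn.ne']
  have hbc : b = ‖b‖ • c := by rw [hc, smul_smul, mul_inv_cancel₀ hbn.ne', one_smul]
  have h1 : ∀ x : Euc (n + 1), max ⟪b, x⟫ 0 = ‖b‖ * max ⟪c, x⟫ 0 := by
    intro x
    conv_lhs => rw [hbc]
    rw [real_inner_smul_left, mul_max_of_nonneg _ _ hbn.le, mul_zero]
  simp_rw [h1]
  rw [integral_const_mul, sphereMeasure_integral]
  set A := ((volume : Measure (Euc (n + 1))).toSphere).real univ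
  have hA : 0 < A := toSphere_mass_pos n
  set P := ∫ x : Metric.sphere (0 : Euc (n + 1)) 1, max ⟪c, (x : Euc (n + 1))⟫ 0
    ∂((volume : Measure (Euc (n + 1))).toSphere)
  have hP0 : 0 ≤ P := integral_nonneg fun x => le_max_right _ _
  have e1 := polar_gauss (fun x : Euc (n + 1) => max ⟪c, x⟫ 0) (by
    intro r x hr
    simp only [real_inner_smul_right]
    rw [mul_max_of_nonneg _ _ hr.le, mul_zero])
  have e2 := gauss_dir c hc1 (fun t => max t 0)
  rw [one_dim_half] at e2
  have e3 := gauss_total n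
  rw [gauss_all] at e3
  have e4 := radial_le n
  have e5 := radial_pos n
  set I0 := ∫ r in Ioi (0 : ℝ), r ^ n * Real.exp (-r ^ 2)
  set I1 := ∫ r in Ioi (0 : ℝ), r ^ (n + 1) * Real.exp (-r ^ 2)
  rw [e2] at e1
  change 1 / 2 * Real.sqrt Real.pi ^ n = P * I1 at e1
  change _ = A * I0 at e3
  set q := Real.sqrt Real.pi with hq
  have hq0 : 0 < q := Real.sqrt_pos.2 Real.pi_pos
  have hq2 : q ^ 2 = Real.pi := Real.sq_sqrt Real.pi_pos.le
  set t := Real.sqrt (((n : ℝ) + 1) / 2)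
  set T := Real.sqrt ((n + 1 : ℕ) : ℝ) with hT
  have hT0 : 0 < T := Real.sqrt_pos.2 (by positivity)
  have htT : t = T / Real.sqrt 2 := by
    rw [hT, ← Real.sqrt_div (by positivity)]; push_cast; rfl
  have hs2 : 0 < Real.sqrt 2 := by positivity
  -- A * I0 = q * q^n = 2 q P I1 ≤ 2 q P t I0
  have e6 : A * I0 ≤ 2 * q * P * t * I0 := by
    calc A * I0 = 2 * q * (1 / 2 * q ^ n) := by rw [← e3]; ring
      _ = 2 * q * P * I1 := by rw [e1]; ring
      _ ≤ 2 * q * P * (t * I0) := by gcongr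
      _ = _ := by ring
  have e7 : A ≤ 2 * q * P * t := le_of_mul_le_mul_right e6 e5
  have e8 : 0.398 * (2 * q) ≤ Real.sqrt 2 := by
    apply Real.le_sqrt_of_sq_le
    have := Real.pi_lt_d4
    nlinarith
  have e9 : 0.398 * A ≤ T * P := by
    have : 2 * q * P * t = (2 * q) * (P * T) / Real.sqrt 2 := by rw [htT]; ring
    rw [this, le_div_iff₀ hs2] at e7
    have h0 : 0 ≤ P * T := by positivity
    have : 0.398 * (A * Real.sqrt 2) ≤ Real.sqrt 2 * (P * T) := by nlinarith
    nlinarith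
  have : 0.398 ≤ T * P / A := by rwa [le_div_iff₀ hA]
  calc 0.398 * ‖b‖ ≤ T * P / A * ‖b‖ := by gcongr
    _ = T * (‖b‖ * (A⁻¹ * P)) := by field_simp

lemma outreach_bdd {N : ℕ} {A : Set (Euc N)} (hA : IsCompact A) (u : Euc N) :
    BddAbove ((fun b => ⟪b, u⟫) '' A) :=
  (hA.image (by fun_prop : Continuous fun b : Euc N => ⟪b, u⟫)).bddAbove

lemma inner_le_outreach {N : ℕ} {A : Set (Euc N)} (hA : IsCompact A) (u : Euc N) {a : Euc N}
    (ha : a ∈ A) : ⟪a, u⟫ ≤ outreach A u :=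
  le_csSup (outreach_bdd hA u) ⟨a, ha, rfl⟩

lemma outreach_le {N : ℕ} {A : Set (Euc N)} (hA : A.Nonempty) {u : Euc N} {t : ℝ}
    (h : ∀ a ∈ A, ⟪a, u⟫ ≤ t) : outreach A u ≤ t := by
  apply csSup_le (hA.image _)
  rintro _ ⟨a, ha, rfl⟩
  exact h a ha

lemma outreach_sub_le {N : ℕ} {A : Set (Euc N)} (hA : IsCompact A) (hne : A.Nonempty) {R : ℝ}
    (hR : ∀ a ∈ A, ‖a‖ ≤ R) (u v : Euc N) : outreach A u ≤ outreach A v + R * ‖u - v‖ := by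
  apply outreach_le hne
  intro a ha
  have h1 : ⟪a, u⟫ = ⟪a, v⟫ + ⟪a, u - v⟫ := by rw [inner_sub_right]; ring
  have h2 := real_inner_le_norm a (u - v)
  have h3 : ‖a‖ * ‖u - v‖ ≤ R * ‖u - v‖ := by gcongr; exact hR a ha
  have h4 := inner_le_outreach hA v ha
  linarith

lemma outreach_lip {N : ℕ} {A : Set (Euc N)} (hA : IsCompact A) (hne : A.Nonempty) {R : ℝ≥0}
    (hR : ∀ a ∈ A, ‖a‖ ≤ R) : LipschitzWith R (outreach A) := by
  apply LipschitzWith.of_dist_le_mul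
  intro u v
  rw [Real.dist_eq, dist_eq_norm, abs_le]
  have h1 := outreach_sub_le hA hne hR u v
  have h2 := outreach_sub_le hA hne hR v u
  rw [norm_sub_rev] at h2
  constructor <;> linarith

lemma outreach_abs_le {N : ℕ} {A : Set (Euc N)} (hA : IsCompact A) (hne : A.Nonempty) {R : ℝ}
    (hR : ∀ a ∈ A, ‖a‖ ≤ R) {u : Euc N} (hu : ‖u‖ = 1) : |outreach A u| ≤ R := by
  rw [abs_le]
  constructor
  · obtain ⟨a, ha⟩ := hne
    have h1 := inner_le_outreach hA u ha
    have h2 := (abs_le.1 (abs_real_inner_le_norm a u)).1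
    have := hR a ha
    rw [hu] at h2
    linarith
  · apply outreach_le hne
    intro a ha
    have h2 := real_inner_le_norm a u
    have := hR a ha
    rw [hu] at h2
    linarith

lemma exists_radius {N : ℕ} {A : Set (Euc N)} (hA : IsCompact A) (hne : A.Nonempty) :
    ∃ a ∈ A, ∀ b ∈ A, ‖b‖ ≤ ‖a‖ := by
  obtain ⟨a, ha, h⟩ := hA.exists_isMaxOn hne continuous_norm.continuousOn
  exact ⟨a, ha, fun b hb => h hb⟩

lemma sphere_nonempty {N : ℕ} (hN : 1 ≤ N) : Nonempty (Metric.sphere (0 : Euc N) 1) :=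
  ⟨⟨EuclideanSpace.single (⟨0, hN⟩ : Fin N) (1 : ℝ), by simp⟩⟩

lemma lip_integrable {N : ℕ} [NeZero N] {f : Euc N → ℝ} (hf : Continuous f) :
    Integrable (fun x : Metric.sphere (0 : Euc N) 1 => f x) (sphereMeasure N) := by
  have : Continuous (fun x : Metric.sphere (0 : Euc N) 1 => f x) := by fun_prop
  exact this.integrable_of_hasCompactSupport (HasCompactSupport.of_compactSpace _)

lemma outreach_cont {N : ℕ} {A : Set (Euc N)} (hA : IsCompact A) (hne : A.Nonempty) :
    Continuous (outreach A) := by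
  obtain ⟨a, -, h⟩ := exists_radius hA hne
  exact (outreach_lip hA hne (R := ‖a‖₊) h).continuous

/-- Quadrature bound for a nonnegative-radius Lipschitz function. -/
lemma quad_bound {N m : ℕ} (hN : 1 ≤ N) {u : Fin m → Euc N} {w : Fin m → ℝ} {ε : ℝ} (hε : 0 ≤ ε)
    (hq : IsAccurateQuadrature u w ε) {f : Euc N → ℝ} {R : ℝ≥0} (hf : LipschitzWith R f)
    (hb : ∀ x : Euc N, ‖x‖ = 1 → |f x| ≤ R) :
    |(∫ x : Metric.sphere (0 : Euc N) 1, f x ∂(sphereMeasure N)) - ∑ i, w i * f (u i)|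
      ≤ 2 * ε * R := by
  refine (hq.2.2 R f hf.lipschitzOnWith).trans ?_
  have := sphere_nonempty hN
  have h : supNormSphere f ≤ R := ciSup_le fun x => hb x (by simpa using x.2)
  have := mul_le_mul_of_nonneg_left h hε
  linarith

lemma quad_outreach {N m : ℕ} (hN : 1 ≤ N) {u : Fin m → Euc N} {w : Fin m → ℝ} {ε : ℝ}
    (hε : 0 ≤ ε) (hq : IsAccurateQuadrature u w ε) {A : Set (Euc N)} (hA : IsCompact A)
    (hne : A.Nonempty) {a : Euc N} (h : ∀ b ∈ A, ‖b‖ ≤ ‖a‖) :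
    |meanHalfWidth A - quadSum u w A| ≤ 2 * ε * ‖a‖ :=
  quad_bound hN hε hq (outreach_lip hA hne (R := ‖a‖₊) h)
    (fun x hx => outreach_abs_le hA hne h hx)

lemma ball_outreach {N : ℕ} {c : ℝ} (hc : 0 ≤ c) {v : Euc N} (hv : ‖v‖ = 1) :
    outreach (closedBall (0 : Euc N) c) v = c := by
  apply le_antisymm
  · apply outreach_le ⟨0, by simpa using hc⟩
    intro a ha
    have h2 := real_inner_le_norm a v
    have : ‖a‖ ≤ c := by simpa using ha
    rw [hv] at h2
    linarith
  · have := inner_le_outreach (isCompact_closedBall (0 : Euc N) c) v (a := c • v)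
      (by simp [norm_smul, hv, abs_of_nonneg hc])
    rw [real_inner_smul_left, real_inner_self_eq_norm_sq, hv] at this
    linarith

/-- The outreach of the inflated set. -/
lemma inflated_outreach {N : ℕ} {B : Set (Euc N)} (hB : IsCompact B) (hne : B.Nonempty)
    {e : ℝ} (he : 0 ≤ e) {v : Euc N} (hv : ‖v‖ = 1)
    (hc : IsCompact (⋂ v ∈ Metric.sphere (0 : Euc N) 1, halfSpace v (outreach B v + e)))
    (hn : (⋂ v ∈ Metric.sphere (0 : Euc N) 1, halfSpace v (outreach B v + e)).Nonempty) :
    outreach (⋂ v ∈ Metric.sphere (0 : Euc N) 1, halfSpace v (outreach B v + e)) v =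
      outreach B v + e := by
  apply le_antisymm
  · apply outreach_le hn
    intro a ha
    simp only [mem_iInter] at ha
    have := ha v (by simpa using hv)
    rw [real_inner_comm]
    exact this
  · rw [← le_sub_iff_add_le]
    apply outreach_le hne
    intro b hb
    have := inner_le_outreach hc v (a := b + e • v) (by
      simp only [mem_iInter]
      intro z hz
      have hz : ‖z‖ = 1 := by simpa using hz
      change ⟪z, b + e • v⟫ ≤ outreach B z + e
      rw [inner_add_right, real_inner_smul_right]
      have h1 := inner_le_outreach hB z hb
      rw [real_inner_comm] at h1
      have h2 := real_inner_le_norm z v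
      rw [hz, hv] at h2
      nlinarith)
    rw [inner_add_left, real_inner_smul_left, real_inner_self_eq_norm_sq, hv] at this
    linarith

lemma inflated_basic {N : ℕ} {B : Set (Euc N)} (hB : IsCompact B) (hne : B.Nonempty)
    {e : ℝ} (he : 0 ≤ e) :
    (⋂ v ∈ Metric.sphere (0 : Euc N) 1, halfSpace v (outreach B v + e)).Nonempty ∧
    Convex ℝ (⋂ v ∈ Metric.sphere (0 : Euc N) 1, halfSpace v (outreach B v + e)) ∧
    (IsCompact (⋂ v ∈ Metric.sphere (0 : Euc N) 1, halfSpace v (outreach B v + e))) := by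
  refine ⟨?_, ?_, ?_⟩
  · obtain ⟨b, hb⟩ := hne
    refine ⟨b, ?_⟩
    simp only [mem_iInter]
    intro z _
    change ⟪z, b⟫ ≤ outreach B z + e
    have h1 := inner_le_outreach hB z hb
    rw [real_inner_comm] at h1
    linarith
  · refine convex_iInter₂ fun z _ => ?_
    exact convex_halfSpace_le (innerₛₗ ℝ z).isLinear _
  · obtain ⟨a, -, ha⟩ := exists_radius hB hne
    refine Metric.isCompact_of_isClosed_isBounded ?_ ?_
    · refine isClosed_biInter fun z _ => ?_
      exact isClosed_le (by fun_prop) continuous_const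
    · refine (isBounded_closedBall (x := (0 : Euc N)) (r := ‖a‖ + e)).subset ?_
      intro x hx
      rw [mem_closedBall_zero_iff]
      rcases eq_or_ne x 0 with rfl | hx0
      · simp; positivity
      have hxn : 0 < ‖x‖ := norm_pos_iff.2 hx0
      have hz : ‖‖x‖⁻¹ • x‖ = 1 := by rw [norm_smul]; simp [hxn.ne']
      simp only [mem_iInter] at hx
      have h1 : ⟪‖x‖⁻¹ • x, x⟫ ≤ outreach B (‖x‖⁻¹ • x) + e := hx _ (by simpa using hz)
      have h2 := (abs_le.1 (outreach_abs_le hB hne ha hz)).2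
      rw [real_inner_smul_left, real_inner_self_eq_norm_sq] at h1
      have : ‖x‖⁻¹ * ‖x‖ ^ 2 = ‖x‖ := by field_simp
      linarith

lemma abs_le_supNorm {N : ℕ} {C : Euc N → ℝ} {LC : ℝ≥0}
    (hC : LipschitzOnWith LC C (Metric.sphere (0 : Euc N) 1)) {v : Euc N} (hv : ‖v‖ = 1) :
    |C v| ≤ supNormSphere C := by
  have hb : BddAbove (range fun x : Metric.sphere (0 : Euc N) 1 => |C x|) := by
    have : Continuous (fun x : Metric.sphere (0 : Euc N) 1 => |C x|) :=
      (continuousOn_iff_continuous_domRestrict.1 hC.continuousOn).abs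
    exact (isCompact_range this).bddAbove
  exact le_ciSup hb (⟨v, by simpa using hv⟩ : Metric.sphere (0 : Euc N) 1)

/-- A direction is within the dispersion of some node. -/
lemma exists_near {N m : ℕ} (u : Fin m → Euc N) (hu : ∀ i, ‖u i‖ = 1) (i0 : Fin m) {v : Euc N}
    (hv : ‖v‖ = 1) :
    ∃ i, ‖v - u i‖ ≤ dispersion (Set.range u) := by
  have : Nonempty (Set.range u) := ⟨⟨u i0, i0, rfl⟩⟩
  have hfin : Finite (Set.range u) := inferInstance
  obtain ⟨⟨z, i, rfl⟩, hz⟩ := exists_eq_ciInf_of_finite (ι := Set.range u)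
    (f := fun z => ‖v - (z : Euc N)‖)
  refine ⟨i, ?_⟩
  simp only at hz
  rw [hz]
  have hb : BddAbove (range fun x : Metric.sphere (0 : Euc N) 1 =>
      ⨅ z : Set.range u, ‖(x : Euc N) - (z : Euc N)‖) := by
    refine ⟨2, ?_⟩
    rintro _ ⟨x, rfl⟩
    have h1 : ⨅ z : Set.range u, ‖(x : Euc N) - (z : Euc N)‖ ≤ ‖(x : Euc N) - u i0‖ :=
      ciInf_le (f := fun z : Set.range u => ‖(x : Euc N) - (z : Euc N)‖)
        ⟨0, by rintro _ ⟨z, rfl⟩; positivity⟩ ⟨u i0, i0, rfl⟩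
    have h2 := norm_sub_le (x : Euc N) (u i0)
    have h3 : ‖(x : Euc N)‖ = 1 := by simpa using x.2
    rw [h3, hu] at h2
    simp only
    linarith
  exact le_ciSup hb (⟨v, by simpa using hv⟩ : Metric.sphere (0 : Euc N) 1)

/-- inflating `𝓑 ∈ 𝒟^γ` by `e = δ(L_C + 12√N(‖C‖_∞ + γ))` in all
directions of the sphere yields a member of `𝒞^{γ+β}` with
`β = e + 32√N(‖C‖_∞ + γ)ε`. -/
theorem inflated_mem_CGamma_continuous {N m : ℕ} (hN : 2 ≤ N)
    (u : Fin m → Euc N) (w : Fin m → ℝ) (ε : ℝ)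
    (hq : IsAccurateQuadrature u w ε)
    (δ : ℝ) (hδ : δ = dispersion (Set.range u))
    (hε : ε ≤ 1 / (10 * Real.sqrt N)) (hδ' : δ ≤ 1 / (10 * Real.sqrt N))
    (C : Euc N → ℝ) (LC : ℝ≥0) (hC : LipschitzOnWith LC C (Metric.sphere (0 : Euc N) 1))
    (γ : ℝ) (hγ : 0 ≤ γ) (B : Set (Euc N)) (hB : B ∈ DGamma u w C γ)
    (e : ℝ) (he : e = δ * ((LC : ℝ) + 12 * Real.sqrt N * (supNormSphere C + γ)))
    (β : ℝ) (hβ : β = e + 32 * Real.sqrt N * (supNormSphere C + γ) * ε) :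
    (⋂ v ∈ Metric.sphere (0 : Euc N) 1, halfSpace v (outreach B v + e)) ∈
      CGamma C (γ + β) := by
  have hN1 : 1 ≤ N := by omega
  have : NeZero N := ⟨by omega⟩
  have hSne := sphere_nonempty hN1
  obtain ⟨v0⟩ := id hSne
  have hv0 : ‖(v0 : Euc N)‖ = 1 := by simpa using v0.2
  have hu : ∀ i, ‖u i‖ = 1 := fun i => by simpa using hq.1 i
  have hw := hq.2.1
  set c := supNormSphere C with hc
  have hcC : ∀ v : Euc N, ‖v‖ = 1 → |C v| ≤ c := fun v hv => abs_le_supNorm hC hv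
  have hc0 : 0 ≤ c := (abs_nonneg _).trans (hcC _ hv0)
  set s := Real.sqrt N with hs
  have hs2 : s ^ 2 = N := Real.sq_sqrt (by positivity)
  have hN2 : (2 : ℝ) ≤ N := by exact_mod_cast hN
  have hs1 : 1.414 ≤ s := Real.le_sqrt_of_sq_le (by norm_num; linarith)
  have hs0 : 0 < s := by linarith
  -- total weight
  set W := ∑ i, w i with hWdef
  have hW : |1 - W| ≤ ε := by
    have h := hq.2.2 0 (fun _ => 1) (LipschitzWith.const 1).lipschitzOnWith
    simpa [supNormSphere] using h
  have hε0 : 0 ≤ ε := (abs_nonneg _).trans hW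
  have hεs : ε * s ≤ 0.1 := by
    rw [le_div_iff₀ (by positivity)] at hε
    linarith
  have hε1 : ε ≤ 0.0708 := by nlinarith
  have hW1 : W ≤ 1 + ε := by linarith [(abs_le.1 hW).1]
  have hW0 : 0 ≤ W := Finset.sum_nonneg fun i _ => hw i
  -- there is a node
  have hm : 0 < m := by
    rcases Nat.eq_zero_or_pos m with rfl | h
    · simp [hWdef] at hW
      linarith
    · exact h
  have hδ0 : 0 ≤ δ := by
    obtain ⟨i, hi⟩ := exists_near u hu ⟨0, hm⟩ hv0
    rw [hδ]
    exact (norm_nonneg _).trans hi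
  have he0 : 0 ≤ e := by rw [he]; positivity
  obtain ⟨⟨hBne, hBconv, hBc, hBf⟩, hBγ⟩ := hB
  -- discrete value
  have hDlow : ∀ A ∈ DInf C (Set.range u), -(W * c) ≤ quadSum u w A := by
    rintro A ⟨_, _, _, hAf⟩
    rw [quadSum, hWdef, Finset.sum_mul, ← Finset.sum_neg_distrib]
    apply Finset.sum_le_sum
    intro i _
    have h1 := hAf (u i) ⟨i, rfl⟩
    have h2 := (abs_le.1 (hcC (u i) (hu i))).1
    nlinarith [hw i]
  have hDbdd : BddBelow (quadSum u w '' DInf C (Set.range u)) := by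
    refine ⟨-(W * c), ?_⟩
    rintro _ ⟨A, hA, rfl⟩
    exact hDlow A hA
  have hCD : CInf C ⊆ DInf C (Set.range u) := by
    rintro A ⟨h1, h2, h3, h4⟩
    refine ⟨h1, h2, h3, ?_⟩
    rintro _ ⟨i, rfl⟩
    exact h4 _ (hq.1 i)
  have hball : closedBall (0 : Euc N) c ∈ CInf C := by
    refine ⟨⟨0, by simpa using hc0⟩, convex_closedBall _ _, isCompact_closedBall _ _, ?_⟩
    intro v hv
    have hv : ‖v‖ = 1 := by simpa using hv
    rw [ball_outreach hc0 hv]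
    exact (le_abs_self _).trans (hcC v hv)
  have hVDPle : ∀ A ∈ DInf C (Set.range u), VDP u w C ≤ quadSum u w A := fun A hA =>
    csInf_le hDbdd ⟨A, hA, rfl⟩
  have hVDP : VDP u w C ≤ W * c := by
    refine (hVDPle _ (hCD hball)).trans (le_of_eq ?_)
    rw [quadSum, hWdef, Finset.sum_mul]
    exact Finset.sum_congr rfl fun i _ => by rw [ball_outreach hc0 (hu i)]
  -- radius of members of CInf
  have hCrad : ∀ A ∈ CInf C, ∀ a ∈ A, 0.398 * ‖a‖ ≤ s * (meanHalfWidth A + c) := by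
    rintro A ⟨h1, h2, h3, h4⟩ a ha
    refine (sphere_pos_part hN1 a).trans ?_
    gcongr
    have hcont := outreach_cont h3 h1
    have : meanHalfWidth A + c =
        ∫ x : Metric.sphere (0 : Euc N) 1, (outreach A x + c) ∂(sphereMeasure N) := by
      rw [integral_add (lip_integrable hcont) (integrable_const _)]
      simp [meanHalfWidth]
    rw [this]
    refine integral_mono (lip_integrable (f := fun x => max ⟪a, x⟫ 0) (by fun_prop))
      (lip_integrable (f := fun x => outreach A x + c) (by fun_prop)) fun x => ?_
    have hx : ‖(x : Euc N)‖ = 1 := by simpa using x.2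
    have e1 := h4 x x.2
    have e2 := (abs_le.1 (hcC x hx)).1
    have e3 := inner_le_outreach h3 (x : Euc N) ha
    exact max_le (by linarith) (by linarith)
  have hClow : ∀ A ∈ CInf C, -c ≤ meanHalfWidth A := by
    intro A hA
    obtain ⟨a, ha⟩ := hA.1
    have h := hCrad A hA a ha
    have h2 : 0 ≤ s * (meanHalfWidth A + c) := le_trans (by positivity) h
    have := nonneg_of_mul_nonneg_right h2 hs0
    linarith
  have hCbdd : BddBelow (meanHalfWidth '' CInf C) := by
    refine ⟨-c, ?_⟩
    rintro _ ⟨A, hA, rfl⟩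
    exact hClow A hA
  have hVCP : VCP C ≤ c := by
    refine (csInf_le hCbdd ⟨_, hball, rfl⟩).trans (le_of_eq ?_)
    have : ∀ x : Metric.sphere (0 : Euc N) 1,
        outreach (closedBall (0 : Euc N) c) (x : Euc N) = c :=
      fun x => ball_outreach hc0 (by simpa using x.2)
    simp [meanHalfWidth, this]
  -- comparing values
  set k := 2 * ε * s / 0.398 with hk
  have hk0 : 0 ≤ k := by positivity
  have hVV : VDP u w C ≤ VCP C + k * (2 * c) := by
    have h1 : (VDP u w C - k * c) / (1 + k) ≤ VCP C := by
      refine le_csInf (Set.Nonempty.image _ ⟨_, hball⟩) ?_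
      rintro _ ⟨A, hA, rfl⟩
      rw [div_le_iff₀ (by positivity)]
      obtain ⟨a, ha, har⟩ := exists_radius hA.2.2.1 hA.1
      have e1 := (abs_le.1 (quad_outreach hN1 hε0 hq hA.2.2.1 hA.1 har)).1
      have e2 := hVDPle A (hCD hA)
      have e3 := hCrad A hA a ha
      have e4 : 2 * ε * ‖a‖ ≤ k * (meanHalfWidth A + c) := by
        have : k * (meanHalfWidth A + c) = 2 * ε * (s * (meanHalfWidth A + c) / 0.398) := by
          rw [hk]; ring
        rw [this]
        gcongr
        rw [le_div_iff₀ (by norm_num)]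
        linarith
      linarith
    rw [div_le_iff₀ (by positivity)] at h1
    nlinarith
  -- radius of B
  obtain ⟨b, hb, hbr⟩ := exists_radius hBc hBne
  have hquadB : quadSum u w B ≤ W * c + γ := by linarith
  have hRb : 0.198 * ‖b‖ ≤ s * (2.1416 * c + γ) := by
    have e1 := sphere_pos_part hN1 b
    have e2 := (abs_le.1 (quad_bound hN1 hε0 hq (f := fun x => max ⟪b, x⟫ 0) (R := ‖b‖₊)
      (by
        apply LipschitzWith.of_dist_le_mul
        intro x y
        rw [Real.dist_eq, dist_eq_norm]
        have h1 := abs_max_sub_max_le_abs ⟪b, x⟫ ⟪b, y⟫ (0 : ℝ)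
        rw [← inner_sub_right] at h1
        exact h1.trans (abs_real_inner_le_norm _ _))
      (by
        intro x hx
        have h1 := real_inner_le_norm b x
        rw [hx, mul_one] at h1
        rw [abs_of_nonneg (le_max_right _ _)]
        exact max_le h1 (norm_nonneg _)))).2
    have e3 : ∑ i, w i * max ⟪b, u i⟫ 0 ≤ quadSum u w B + W * c := by
      rw [quadSum, hWdef, Finset.sum_mul, ← Finset.sum_add_distrib]
      apply Finset.sum_le_sum
      intro i _
      rw [← mul_add]
      have h1 := hBf (u i) ⟨i, rfl⟩
      have h2 := (abs_le.1 (hcC (u i) (hu i))).1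
      have h3 := inner_le_outreach hBc (u i) hb
      exact mul_le_mul_of_nonneg_left (max_le (by linarith) (by linarith)) (hw i)
    have e4 : W * c ≤ 1.0708 * c := mul_le_mul_of_nonneg_right (by linarith) hc0
    simp only [coe_nnnorm] at e2
    have e5 : ∫ x : Metric.sphere (0 : Euc N) 1, max ⟪b, (x : Euc N)⟫ 0 ∂(sphereMeasure N) ≤
        2.1416 * c + γ + 2 * ε * ‖b‖ := by linarith
    have e6 := mul_le_mul_of_nonneg_left e5 hs0.le
    have e7 : s * (2 * ε * ‖b‖) ≤ 0.2 * ‖b‖ := by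
      have := mul_le_mul_of_nonneg_right hεs (norm_nonneg b)
      linarith
    linarith
  have hsc : 0 ≤ s * c := by positivity
  have hsγ : 0 ≤ s * γ := by positivity
  have hR11 : ‖b‖ ≤ 10.82 * (s * c) + 5.06 * (s * γ) := by linarith
  have hR12 : ‖b‖ ≤ 12 * s * (c + γ) := by linarith
  obtain ⟨hIne, hIconv, hIc⟩ := inflated_basic hBc hBne he0
  have hout : ∀ v : Euc N, ‖v‖ = 1 → _ := fun v hv =>
    inflated_outreach hBc hBne he0 hv hIc hIne
  refine ⟨⟨hIne, hIconv, hIc, ?_⟩, ?_⟩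
  · intro v hv
    have hv1 : ‖v‖ = 1 := by simpa using hv
    rw [hout v hv1]
    obtain ⟨i, hi⟩ := exists_near u hu ⟨0, hm⟩ hv1
    rw [← hδ] at hi
    have h1 := outreach_sub_le hBc hBne hbr (u i) v
    rw [norm_sub_rev] at h1
    have h2 := hBf (u i) ⟨i, rfl⟩
    have h3 := hC.dist_le_mul v hv (u i) (hq.1 i)
    rw [Real.dist_eq, dist_eq_norm] at h3
    have h4 := (abs_le.1 h3).2
    have h5 : (LC : ℝ) * ‖v - u i‖ ≤ LC * δ := by gcongr
    have h6 : ‖b‖ * ‖v - u i‖ ≤ 12 * s * (c + γ) * δ := by gcongr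
    rw [he]
    linarith
  · have hmean : meanHalfWidth (⋂ v ∈ Metric.sphere (0 : Euc N) 1,
        halfSpace v (outreach B v + e)) = meanHalfWidth B + e := by
      have : ∀ x : Metric.sphere (0 : Euc N) 1,
          outreach (⋂ v ∈ Metric.sphere (0 : Euc N) 1, halfSpace v (outreach B v + e))
            (x : Euc N) = outreach B x + e := fun x => hout x (by simpa using x.2)
      rw [meanHalfWidth]
      simp_rw [this]
      rw [integral_add (lip_integrable (outreach_cont hBc hBne)) (integrable_const _)]
      simp [meanHalfWidth]
    rw [hmean, hβ]
    have h1 := (abs_le.1 (quad_outreach hN1 hε0 hq hBc hBne hbr)).2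
    have h2 : 2 * ε * ‖b‖ ≤ 2 * ε * (10.82 * (s * c) + 5.06 * (s * γ)) := by gcongr
    have h3 : k * (2 * c) ≤ 10.06 * (ε * (s * c)) := by
      have : k * (2 * c) = 4 / 0.398 * (ε * (s * c)) := by rw [hk]; ring
      rw [this]
      gcongr
      norm_num
    have h4 : 0 ≤ ε * (s * c) := by positivity
    have h5 : 0 ≤ ε * (s * γ) := by positivity
    linarith
end
end

section
/- Let 𝒮 = {u_i}_{i=1}^m ⊆ S^{N-1} have dispersion δ = disp(𝒮), and let {(v_j,z_j)}_{j=1}^m ⊆ S^{N-1} × [0,∞) be an ε-accurate quadrature. For each j, let p_j ∈ {1,…,m} be an index with ‖u_{p_j} − v_j‖ = min_i ‖u_i − v_j‖, and set w_i = Σ_{j : p_j = i} z_j. Then {(u_i,w_i)}_{i=1}^m is a (δ + ε(1+δ))-accurate quadrature. -/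
open MeasureTheory Metric Set TopologicalSpace Filter
open scoped RealInnerProductSpace NNReal ENNReal

noncomputable section

/-- projecting an `ε`-accurate quadrature `{(v_j,z_j)}` onto a node set
`{u_i}` of dispersion `δ` (each `v_j` is sent to a closest `u_{p_j}` and weights are
aggregated) yields a `(δ + ε(1+δ))`-accurate quadrature. -/
theorem projected_quadrature_accurate {N m : ℕ}
    (u : Fin m → Euc N) (hu : ∀ i, u i ∈ Metric.sphere (0 : Euc N) 1)
    (δ : ℝ) (hδ : δ = dispersion (Set.range u))
    (v : Fin m → Euc N) (z : Fin m → ℝ) (ε : ℝ)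
    (hq : IsAccurateQuadrature v z ε)
    (p : Fin m → Fin m) (hp : ∀ j i, ‖u (p j) - v j‖ ≤ ‖u i - v j‖)
    (w : Fin m → ℝ)
    (hw : ∀ i, w i = ∑ j ∈ Finset.univ.filter (fun j => p j = i), z j) :
    IsAccurateQuadrature u w (δ + ε * (1 + δ)) := by
  obtain ⟨hv, hz, hq⟩ := hq
  refine ⟨hu, fun i => by rw [hw]; exact Finset.sum_nonneg (fun j _ => hz j), ?_⟩
  intro L f hf
  have hsum : ∑ i, w i * f (u i) = ∑ j, z j * f (u (p j)) := by
    rw [← Finset.sum_fiberwise Finset.univ p (fun j => z j * f (u (p j)))]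
    refine Finset.sum_congr rfl fun i _ => ?_
    rw [hw, Finset.sum_mul]
    refine Finset.sum_congr rfl fun j hj => ?_
    rw [(Finset.mem_filter.mp hj).2]
  have h1 := hq L f hf
  have hF : 0 ≤ supNormSphere f := Real.iSup_nonneg fun _ => abs_nonneg _
  have hδ0 : 0 ≤ δ := by
    rw [hδ]
    exact Real.iSup_nonneg fun _ => Real.iInf_nonneg fun _ => norm_nonneg _
  rcases Nat.eq_zero_or_pos m with hm | hm
  · subst hm
    have hd : δ = 0 := by
      rw [hδ]
      unfold dispersion
      have : IsEmpty (Set.range u) := by simp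
      simp [Real.iInf_of_isEmpty]
    subst hd
    simpa using h1
  have i0 : Fin m := ⟨0, hm⟩
  have : Nonempty (Metric.sphere (0 : Euc N) 1) := ⟨⟨u i0, hu i0⟩⟩
  have h2 := hq 0 (fun _ => 1) (LipschitzWith.const (1 : ℝ)).lipschitzOnWith
  have hs1 : supNormSphere (fun _ : Euc N => (1 : ℝ)) = 1 := by
    simp [supNormSphere]
  have hmeas : (sphereMeasure N).real Set.univ ≤ 1 := by
    refine ENNReal.toReal_le_of_le_ofReal zero_le_one ?_
    rw [ENNReal.ofReal_one]
    simp only [sphereMeasure, Measure.smul_apply, smul_eq_mul]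
    exact ENNReal.inv_mul_le_one _
  simp only [hs1, integral_const, smul_eq_mul, mul_one, NNReal.coe_zero, zero_add] at h2
  have hε : 0 ≤ ε := (abs_nonneg _).trans h2
  have hZ : ∑ j, z j ≤ 1 + ε := by
    have := (abs_le.mp h2).1
    linarith
  have hdist : ∀ j, ‖u (p j) - v j‖ ≤ δ := by
    intro j
    rw [hδ]
    have hne : Nonempty (Set.range u) := ⟨⟨u i0, i0, rfl⟩⟩
    have hb : BddAbove (Set.range fun x : Metric.sphere (0 : Euc N) 1 =>
        ⨅ y : Set.range u, ‖(x : Euc N) - (y : Euc N)‖) := by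
      refine ⟨2, ?_⟩
      rintro _ ⟨x, rfl⟩
      refine (ciInf_le ⟨0, ?_⟩ (⟨u i0, i0, rfl⟩ : Set.range u)).trans ?_
      · rintro _ ⟨y, rfl⟩
        exact norm_nonneg _
      · have a := mem_sphere_zero_iff_norm.mp x.2
        have b := mem_sphere_zero_iff_norm.mp (hu i0)
        have c := norm_sub_le (x : Euc N) (u i0)
        simp only
        linarith
    refine le_trans ?_ (le_ciSup hb ⟨v j, hv j⟩)
    refine le_ciInf ?_
    rintro ⟨_, i, rfl⟩
    rw [norm_sub_rev (v j) (u i)]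
    exact hp j i
  have hL : (0 : ℝ) ≤ L := L.2
  have h3 : |∑ j, z j * f (v j) - ∑ j, z j * f (u (p j))| ≤ (1 + ε) * (L * δ) := by
    rw [← Finset.sum_sub_distrib]
    calc _ ≤ ∑ j, |z j * f (v j) - z j * f (u (p j))| := Finset.abs_sum_le_sum_abs _ _
      _ ≤ ∑ j, z j * (L * δ) := by
        refine Finset.sum_le_sum fun j _ => ?_
        rw [← mul_sub, abs_mul, abs_of_nonneg (hz j)]
        refine mul_le_mul_of_nonneg_left ?_ (hz j)
        have := hf.dist_le_mul _ (hv j) _ (hu (p j))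
        rw [Real.dist_eq, dist_eq_norm, norm_sub_rev] at this
        exact this.trans (mul_le_mul_of_nonneg_left (hdist j) hL)
      _ = (∑ j, z j) * (L * δ) := by rw [Finset.sum_mul]
      _ ≤ _ := mul_le_mul_of_nonneg_right hZ (by positivity)
  rw [hsum]
  refine (abs_sub_le _ (∑ j, z j * f (v j)) _).trans ((add_le_add h1 h3).trans ?_)
  have : 0 ≤ (δ * (1 + ε)) * supNormSphere f := by positivity
  nlinarith
end
end
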